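/- (b = 1 data forging is impossible for multiclass logistic regression.) Let d ≥ 1, n ≥ 2, W ∈ ℝ^{d×n} and b ∈ ℝ^n. Let (x, y), (x', y') ∈ ℝ^d × ℝ^n with y and y' one-hot. If the gradient of the per-example loss ℓ(softmax(Wᵀx + b), y) with respect to W at (x, y) equals the corresponding gradient at (x', y'), and the gradient with respect to b at (x, y) equals the corresponding gradient at (x', y'), then x = x' and y = y'. -/

import Mathlib

open scoped BigOperators

/-- `softmax z i = exp (z i) / ∑ j, exp (z j)`. -/
noncomputable def softmax {n : ℕ} (z : Fin n → ℝ) : Fin n → ℝ :=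
  fun i => Real.exp (z i) / ∑ j, Real.exp (z j)

/-- Cross-entropy loss `ℓ(ŷ, y) = -∑ i, y i * log (ŷ i)`. -/
noncomputable def xent {n : ℕ} (yhat y : Fin n → ℝ) : ℝ :=
  -∑ i, y i * Real.log (yhat i)

/-- `tmulVec W x = Wᵀ x`, i.e. `(tmulVec W x) j = ∑ m, W m j * x m`. -/
def tmulVec {d n : ℕ} (W : Fin d → Fin n → ℝ) (x : Fin d → ℝ) : Fin n → ℝ :=
  fun j => ∑ m, W m j * x m

/-- A label is one-hot if every entry is `0` or `1` and the entries sum to `1`. -/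
def IsOneHot {n : ℕ} (y : Fin n → ℝ) : Prop :=
  (∀ i, y i = 0 ∨ y i = 1) ∧ ∑ i, y i = 1

/-- The gradient of the loss with respect to the logits. -/
noncomputable def lossGrad {n : ℕ} (y z : Fin n → ℝ) : (Fin n → ℝ) →L[ℝ] ℝ :=
  ∑ i, (softmax z i - y i) • (ContinuousLinearMap.proj i : (Fin n → ℝ) →L[ℝ] ℝ)

lemma lossGrad_apply {n : ℕ} (y z v : Fin n → ℝ) :
    lossGrad y z v = ∑ i, (softmax z i - y i) * v i := by
  simp [lossGrad]

lemma sum_exp_pos {n : ℕ} (hn : 2 ≤ n) (z : Fin n → ℝ) : 0 < ∑ j, Real.exp (z j) :=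
  Finset.sum_pos (fun _ _ => Real.exp_pos _) ⟨⟨0, by omega⟩, Finset.mem_univ _⟩

lemma xent_softmax {n : ℕ} (hn : 2 ≤ n) (y z : Fin n → ℝ) (hy : IsOneHot y) :
    xent (softmax z) y = Real.log (∑ j, Real.exp (z j)) - ∑ i, y i * z i := by
  have hS := sum_exp_pos hn z
  have h : ∀ i, y i * Real.log (softmax z i)
      = y i * z i - y i * Real.log (∑ j, Real.exp (z j)) := by
    intro i
    unfold softmax
    rw [Real.log_div (Real.exp_pos _).ne' hS.ne', Real.log_exp]
    ring
  unfold xent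
  rw [Finset.sum_congr rfl (fun i _ => h i), Finset.sum_sub_distrib, ← Finset.sum_mul, hy.2]
  ring

lemma hasFDerivAt_loss {n : ℕ} (hn : 2 ≤ n) (y z : Fin n → ℝ) (hy : IsOneHot y) :
    HasFDerivAt (fun z => xent (softmax z) y) (lossGrad y z) z := by
  have hS := sum_exp_pos hn z
  have h0 : (fun z => xent (softmax z) y)
      = fun z => Real.log (∑ j, Real.exp (z j)) - ∑ i, y i * z i :=
    funext fun z => xent_softmax hn y z hy
  rw [h0]
  have hp : ∀ i, HasFDerivAt (fun z : Fin n → ℝ => z i)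
      (ContinuousLinearMap.proj i : (Fin n → ℝ) →L[ℝ] ℝ) z := fun i => hasFDerivAt_apply i z
  have h1 := (HasFDerivAt.fun_sum (u := Finset.univ) (fun i _ => (hp i).exp)).log hS.ne'
  have h2 := HasFDerivAt.fun_sum (u := Finset.univ) (fun i _ => (hp i).const_mul (y i))
  refine (h1.sub h2).congr_fderiv ?_
  ext v
  simp only [lossGrad_apply, softmax, sub_mul, Finset.sum_sub_distrib]
  simp [Finset.mul_sum, div_eq_inv_mul, mul_assoc]

lemma softmax_bounds {n : ℕ} (hn : 2 ≤ n) (z : Fin n → ℝ) (i : Fin n) :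
    0 < softmax z i ∧ softmax z i < 1 := by
  have hS := sum_exp_pos hn z
  refine ⟨div_pos (Real.exp_pos _) hS, ?_⟩
  unfold softmax
  rw [div_lt_one hS]
  haveI : Nontrivial (Fin n) := Fin.nontrivial_iff_two_le.mpr hn
  obtain ⟨j, hj⟩ := exists_ne i
  exact Finset.single_lt_sum hj (Finset.mem_univ i) (Finset.mem_univ j) (Real.exp_pos _)
    (fun k _ _ => (Real.exp_pos _).le)

lemma fderiv_b {n : ℕ} (hn : 2 ≤ n) (y c b : Fin n → ℝ) (hy : IsOneHot y) :
    fderiv ℝ (fun β : Fin n → ℝ => xent (softmax (fun j => c j + β j)) y) b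
      = lossGrad y (fun j => c j + b j) := by
  have h : HasFDerivAt (fun β : Fin n → ℝ => c + β) (ContinuousLinearMap.id ℝ (Fin n → ℝ)) b :=
    (hasFDerivAt_id b).const_add c
  exact ((hasFDerivAt_loss hn y (c + b) hy).comp b h).fderiv

/-- `V ↦ Vᵀ x` as a continuous linear map. -/
noncomputable def tmulCLM {d n : ℕ} (x : Fin d → ℝ) : (Fin d → Fin n → ℝ) →L[ℝ] (Fin n → ℝ) :=
  LinearMap.toContinuousLinearMap
    { toFun := fun V => tmulVec V x
      map_add' := by
        intro V U; ext j; simp [tmulVec, add_mul, Finset.sum_add_distrib]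
      map_smul' := by
        intro r V; ext j; simp [tmulVec, Finset.mul_sum, mul_assoc] }

lemma fderiv_W {d n : ℕ} (hn : 2 ≤ n) (W : Fin d → Fin n → ℝ) (x : Fin d → ℝ)
    (y b : Fin n → ℝ) (hy : IsOneHot y) (V : Fin d → Fin n → ℝ) :
    fderiv ℝ (fun V : Fin d → Fin n → ℝ => xent (softmax (fun j => tmulVec V x j + b j)) y) W V
      = lossGrad y (fun j => tmulVec W x j + b j) (tmulVec V x) := by
  have h : HasFDerivAt (fun V : Fin d → Fin n → ℝ => tmulCLM x V + b) (tmulCLM x) W :=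
    (tmulCLM x).hasFDerivAt.add_const b
  have h2 := ((hasFDerivAt_loss hn y (tmulCLM x W + b) hy).comp W h).fderiv
  exact congrArg (fun L => L V) h2

/-- `b = 1` data forging is impossible for multiclass logistic regression
`x ↦ softmax (Wᵀ x + b)`: if the Fréchet gradients of the per-example cross-entropy
loss with respect to `W` and with respect to `b` coincide at `(x, y)` and
`(x', y')`, with `y, y'` one-hot and `n ≥ 2`, then `x = x'` and `y = y'`. -/
theorem no_single_example_forging_logreg (d n : ℕ) (hd : 1 ≤ d) (hn : 2 ≤ n)
    (W : Fin d → Fin n → ℝ) (b : Fin n → ℝ)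
    (x x' : Fin d → ℝ) (y y' : Fin n → ℝ) (hy : IsOneHot y) (hy' : IsOneHot y')
    (hW : fderiv ℝ (fun V : Fin d → Fin n → ℝ =>
            xent (softmax (fun j => tmulVec V x j + b j)) y) W
        = fderiv ℝ (fun V : Fin d → Fin n → ℝ =>
            xent (softmax (fun j => tmulVec V x' j + b j)) y') W)
    (hb : fderiv ℝ (fun β : Fin n → ℝ =>
            xent (softmax (fun j => tmulVec W x j + β j)) y) b
        = fderiv ℝ (fun β : Fin n → ℝ =>
            xent (softmax (fun j => tmulVec W x' j + β j)) y') b) :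
    x = x' ∧ y = y' := by
  rw [fderiv_b hn y _ b hy, fderiv_b hn y' _ b hy'] at hb
  have hW' := fun V => congrArg (fun L => L V) hW
  simp only [fderiv_W hn W _ _ b hy, fderiv_W hn W _ _ b hy'] at hW'
  rw [← hb] at hW'
  have hg : ∀ i, softmax (fun j => tmulVec W x j + b j) i - y i
      = softmax (fun j => tmulVec W x' j + b j) i - y' i := by
    intro i
    have := congrArg (fun L => L (Pi.single i 1)) hb
    simpa [lossGrad_apply, Pi.single_apply] using this
  have hyy : y = y' := by
    ext i
    have h1 := softmax_bounds hn (fun j => tmulVec W x j + b j) i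
    have h2 := softmax_bounds hn (fun j => tmulVec W x' j + b j) i
    have h3 := hg i
    rcases hy.1 i with h | h <;> rcases hy'.1 i with h' | h' <;> rw [h, h'] at h3 ⊢ <;> linarith
  refine ⟨?_, hyy⟩
  obtain ⟨j, hj⟩ : ∃ j, y j = 1 := by
    by_contra hne
    have h0 : ∀ i, y i = 0 := fun i => (hy.1 i).resolve_right (fun h => hne ⟨i, h⟩)
    have := hy.2
    simp [h0] at this
  have h1 := softmax_bounds hn (fun j => tmulVec W x j + b j) j
  have hne : softmax (fun j => tmulVec W x j + b j) j - y j ≠ 0 := by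
    rw [hj]; exact (sub_neg.mpr h1.2).ne
  ext m
  have h := hW' (Pi.single m (Pi.single j 1))
  have ht : ∀ u : Fin d → ℝ, tmulVec (Pi.single m (Pi.single j 1)) u
      = (Pi.single j (u m) : Fin n → ℝ) := by
    intro u
    ext k
    unfold tmulVec
    rw [Finset.sum_eq_single m]
    · by_cases hk : k = j
      · subst hk; simp
      · simp [hk]
    · intro l _ hl
      simp [hl]
    · simp
  rw [ht, ht, lossGrad_apply, lossGrad_apply] at h
  simp only [Pi.single_apply, mul_ite, mul_zero, Finset.sum_ite_eq', Finset.mem_univ, if_true] at h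
  exact mul_left_cancel₀ hne h
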